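/- Let $Z, X, A, S$ be finite sets, $\delta \in (0,1)$, $G \ge 0$, and let $Q^{(t)}, \bar Q^{(t)}$ be sequences generated by Bellman-type iterations under signal models $\mu^{(t)}, \bar\mu^{(t)}$ respectively, with bounded reward $|g| \le G$, initialized with $\|Q^{(0)}\|_\infty, \|\bar Q^{(0)}\|_\infty \le \frac{G}{1-\delta}$. If $\varepsilon_\mu := \sup_t \max_{z,x,s}|\mu^{(t)}(z,x)[s] - \bar\mu^{(t)}(z,x)[s]|$, then $\limsup_{t\to\infty} \|Q^{(t)} - \bar Q^{(t)}\|_\infty \le \frac{\varepsilon_\mu |S| G}{(1-\delta)^2}$. -/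

import Mathlib

theorem aux_avg {I : Type*} [Fintype I] (p v : I → ℝ) (D : ℝ) (hp : ∀ i, 0 ≤ p i)
    (h1 : ∑ i, p i = 1) (hv : ∀ i, |v i| ≤ D) : |∑ i, p i * v i| ≤ D := by
  calc |∑ i, p i * v i| ≤ ∑ i, |p i * v i| := Finset.abs_sum_le_sum_abs _ _
    _ ≤ ∑ i, p i * D := by
        apply Finset.sum_le_sum
        intro i _
        rw [abs_mul, abs_of_nonneg (hp i)]
        exact mul_le_mul_of_nonneg_left (hv i) (hp i)
    _ = D := by rw [← Finset.sum_mul, h1, one_mul]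

theorem aux_sup {I : Type*} [Fintype I] [Nonempty I] (f h : I → ℝ) (D : ℝ)
    (hv : ∀ i, |f i - h i| ≤ D) : |(⨆ i, f i) - ⨆ i, h i| ≤ D := by
  have bf := (Set.finite_range f).bddAbove
  have bh := (Set.finite_range h).bddAbove
  have e1 : (⨆ i, f i) ≤ (⨆ i, h i) + D := ciSup_le fun i => by
    have := le_ciSup bh i
    have := (abs_le.1 (hv i)).2
    linarith
  have e2 : (⨆ i, h i) ≤ (⨆ i, f i) + D := ciSup_le fun i => by
    have := le_ciSup bf i
    have := (abs_le.1 (hv i)).1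
    linarith
  rw [abs_le]
  constructor <;> linarith

theorem stmt_7 {Z X A S : Type*} [Fintype Z] [Fintype X] [Fintype A] [Fintype S]
    [Nonempty Z] [Nonempty X] [Nonempty A] [Nonempty S]
    (δ G εμ : ℝ) (hδ : δ ∈ Set.Ioo (0:ℝ) 1) (hG : 0 ≤ G) (hεμ : 0 ≤ εμ)
    (g : X → A → S → ℝ) (hg : ∀ x a s, |g x a s| ≤ G)
    (l : Z → S → Z)
    (φ : X → S → A → X → ℝ) (hφ0 : ∀ x s a x', 0 ≤ φ x s a x')
    (hφ1 : ∀ x s a, ∑ x', φ x s a x' = 1)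
    (μ μ' : ℕ → Z → X → S → ℝ)
    (hμ0 : ∀ t z x s, 0 ≤ μ t z x s) (hμ1 : ∀ t z x, ∑ s, μ t z x s = 1)
    (hμ'0 : ∀ t z x s, 0 ≤ μ' t z x s) (hμ'1 : ∀ t z x, ∑ s, μ' t z x s = 1)
    (hclose : ∀ t z x s, |μ t z x s - μ' t z x s| ≤ εμ)
    (Q Q' : ℕ → Z → X → A → ℝ)
    (hQ0 : ∀ z x a, |Q 0 z x a| ≤ G / (1 - δ))
    (hQ'0 : ∀ z x a, |Q' 0 z x a| ≤ G / (1 - δ))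
    (hiter : ∀ t z x a, Q (t + 1) z x a =
      ∑ s, μ t z x s * (g x a s + δ * ∑ x', φ x s a x' * (⨆ a', Q t (l z s) x' a')))
    (hiter' : ∀ t z x a, Q' (t + 1) z x a =
      ∑ s, μ' t z x s * (g x a s + δ * ∑ x', φ x s a x' * (⨆ a', Q' t (l z s) x' a'))) :
    Filter.limsup (fun t => ⨆ z, ⨆ x, ⨆ a, |Q t z x a - Q' t z x a|) Filter.atTop
      ≤ εμ * (Fintype.card S : ℝ) * G / (1 - δ) ^ 2 := by
  obtain ⟨hd0, hd1⟩ := hδ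
  have hd : 0 < 1 - δ := by linarith
  obtain ⟨B, hB⟩ : ∃ B, B = G / (1 - δ) := ⟨_, rfl⟩
  have hBG : G + δ * B = B := by rw [hB]; field_simp; ring
  rw [← hB] at hQ0 hQ'0
  have hB0 : 0 ≤ B := by rw [hB]; positivity
  have inner : ∀ (q : Z → X → A → ℝ), (∀ z x a, |q z x a| ≤ B) → ∀ z x a s,
      |g x a s + δ * ∑ x', φ x s a x' * (⨆ a', q (l z s) x' a')| ≤ B := by
    intro q hq z x a s
    have h1 : |∑ x', φ x s a x' * (⨆ a', q (l z s) x' a')| ≤ B := by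
      apply aux_avg _ _ _ (hφ0 x s a) (hφ1 x s a)
      intro x'
      have := aux_sup (fun a' => q (l z s) x' a') (fun _ => 0) B (by simpa using hq _ _)
      simpa using this
    refine (abs_add_le _ _).trans ?_
    rw [abs_mul, abs_of_pos hd0]
    have := mul_le_mul_of_nonneg_left h1 hd0.le
    have := hg x a s
    linarith
  have bQ : ∀ t z x a, |Q t z x a| ≤ B := by
    intro t
    induction t with
    | zero => exact hQ0
    | succ t ih =>
      intro z x a
      rw [hiter]
      exact aux_avg _ _ _ (hμ0 t z x) (hμ1 t z x) (inner _ ih z x a)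
  have bQ' : ∀ t z x a, |Q' t z x a| ≤ B := by
    intro t
    induction t with
    | zero => exact hQ'0
    | succ t ih =>
      intro z x a
      rw [hiter']
      exact aux_avg _ _ _ (hμ'0 t z x) (hμ'1 t z x) (inner _ ih z x a)
  obtain ⟨K, hK⟩ : ∃ K, K = εμ * (Fintype.card S : ℝ) * G / (1 - δ) ^ 2 := ⟨_, rfl⟩
  have hKB : δ * K + εμ * (Fintype.card S : ℝ) * B = K := by
    rw [hK, hB]; field_simp; ring
  have hK0 : 0 ≤ K := by rw [hK]; positivity
  rw [← hK]
  have key : ∀ t z x a, |Q t z x a - Q' t z x a| ≤ δ ^ t * (2 * B) + K := by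
    intro t
    induction t with
    | zero =>
      intro z x a
      have h1 := abs_sub (Q 0 z x a) (Q' 0 z x a)
      have h2 := hQ0 z x a
      have h3 := hQ'0 z x a
      simp only [pow_zero]
      linarith
    | succ t ih =>
      intro z x a
      have e : Q (t+1) z x a - Q' (t+1) z x a =
          δ * (∑ s, μ t z x s * ∑ x', φ x s a x' *
            ((⨆ a', Q t (l z s) x' a') - ⨆ a', Q' t (l z s) x' a'))
          + ∑ s, (μ t z x s - μ' t z x s) *
            (g x a s + δ * ∑ x', φ x s a x' * (⨆ a', Q' t (l z s) x' a')) := by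
        rw [hiter, hiter', Finset.mul_sum, ← Finset.sum_sub_distrib, ← Finset.sum_add_distrib]
        refine Finset.sum_congr rfl fun s _ => ?_
        simp only [mul_sub, Finset.sum_sub_distrib]
        ring
      have h1 : |∑ s, μ t z x s * ∑ x', φ x s a x' *
            ((⨆ a', Q t (l z s) x' a') - ⨆ a', Q' t (l z s) x' a')| ≤ δ ^ t * (2 * B) + K :=
        aux_avg _ _ _ (hμ0 t z x) (hμ1 t z x) fun s =>
          aux_avg _ _ _ (hφ0 x s a) (hφ1 x s a) fun x' => aux_sup _ _ _ (ih _ _)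
      have h2 : |∑ s, (μ t z x s - μ' t z x s) *
            (g x a s + δ * ∑ x', φ x s a x' * (⨆ a', Q' t (l z s) x' a'))|
            ≤ εμ * (Fintype.card S : ℝ) * B := by
        calc _ ≤ ∑ s, |(μ t z x s - μ' t z x s) *
            (g x a s + δ * ∑ x', φ x s a x' * (⨆ a', Q' t (l z s) x' a'))| :=
              Finset.abs_sum_le_sum_abs _ _
          _ ≤ ∑ s : S, εμ * B := by
              apply Finset.sum_le_sum
              intro s _
              rw [abs_mul]
              exact mul_le_mul (hclose t z x s) (inner _ (bQ' t) z x a s) (abs_nonneg _) hεμ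
          _ = _ := by
              rw [Finset.sum_const, Finset.card_univ, nsmul_eq_mul]; ring
      rw [e]
      refine (abs_add_le _ _).trans ?_
      rw [abs_mul, abs_of_pos hd0]
      have h3 := mul_le_mul_of_nonneg_left h1 hd0.le
      have h4 : δ * (δ ^ t * (2 * B) + K) = δ ^ (t+1) * (2 * B) + δ * K := by ring
      linarith
  have lim : Filter.Tendsto (fun t : ℕ => δ ^ t * (2 * B) + K) Filter.atTop (nhds K) := by
    simpa using ((tendsto_pow_atTop_nhds_zero_of_lt_one hd0.le hd1).mul_const (2 * B)).add_const K
  rw [← lim.limsup_eq]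
  refine Filter.limsup_le_limsup (Filter.Eventually.of_forall fun t => ?_) ?_
    lim.isBoundedUnder_le
  · exact ciSup_le fun z => ciSup_le fun x => ciSup_le fun a => key t z x a
  · refine Filter.IsCoboundedUnder.of_frequently_ge (a := 0) (Filter.Frequently.of_forall fun t => ?_)
    exact Real.iSup_nonneg fun z => Real.iSup_nonneg fun x => Real.iSup_nonneg fun a => abs_nonneg _
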